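/- arXiv:2406.13370 — 7 statements merged into one kernel-verified Lean document; each statement's English description precedes it below -/
import Mathlib

section
/- Let ρ ∈ (0,1) and let g, ψ : [0,∞) → [0,∞) be continuous functions such that g(t) ≤ (ρ/t)·∫₀ᵗ g(s) ds + ψ(t) for every t > 0. Then for every t > 0 one has g(t) ≤ ρ·t^{ρ−1}·∫₀ᵗ s^{−ρ} ψ(s) ds + ψ(t). -/
open MeasureTheory Set

/-- The weighted primitive `t ^ (-ρ) * ∫₀ᵗ g` is continuous up to `0` when `ρ < 1`. -/
lemma continuousOn_rpow_neg_mul_integral {ρ T : ℝ} {g : ℝ → ℝ} (hρ : ρ < 1)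
    (hT : 0 ≤ T) (hg : ContinuousOn g (Icc 0 T)) :
    ContinuousOn (fun t => t ^ (-ρ) * ∫ s in (0:ℝ)..t, g s) (Icc 0 T) := by
  have hG : ContinuousOn (fun t => ∫ s in (0:ℝ)..t, g s) (Icc 0 T) := by
    have := intervalIntegral.continuousOn_primitive_interval (μ := volume) (f := g) (a := 0) (b := T)
      (by rw [uIcc_of_le hT]; exact hg.integrableOn_Icc)
    rwa [uIcc_of_le hT] at this
  intro x hx
  rcases hx.1.eq_or_lt with rfl | hx0
  · obtain ⟨M, hM⟩ := isCompact_Icc.exists_bound_of_continuousOn hg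
    have hlim : Filter.Tendsto (fun t : ℝ => M * t ^ (1 - ρ)) (nhdsWithin 0 (Icc 0 T))
        (nhds 0) := by
      have h : ContinuousAt (fun t : ℝ => M * t ^ (1 - ρ)) 0 :=
        continuousAt_const.mul
          (Real.continuousAt_rpow_const 0 (1 - ρ) (Or.inr (by linarith)))
      have h' := h.tendsto
      rw [Real.zero_rpow (by linarith), mul_zero] at h'
      exact h'.mono_left nhdsWithin_le_nhds
    rw [ContinuousWithinAt, intervalIntegral.integral_same, mul_zero]
    refine squeeze_zero_norm' ?_ hlim
    filter_upwards [self_mem_nhdsWithin] with t ht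
    rcases ht.1.eq_or_lt with rfl | ht0
    · simp [Real.zero_rpow (show 1 - ρ ≠ 0 by linarith)]
    have hbound : ‖∫ s in (0:ℝ)..t, g s‖ ≤ M * |t - 0| := by
      refine intervalIntegral.norm_integral_le_of_norm_le_const fun s hs => hM s ?_
      rw [uIoc_of_le ht.1] at hs
      exact ⟨hs.1.le, hs.2.trans ht.2⟩
    rw [sub_zero, abs_of_pos ht0] at hbound
    have hpos : 0 < t ^ (-ρ) := Real.rpow_pos_of_pos ht0 _
    rw [norm_mul, Real.norm_of_nonneg hpos.le]
    calc t ^ (-ρ) * ‖∫ s in (0:ℝ)..t, g s‖ ≤ t ^ (-ρ) * (M * t) := by gcongr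
      _ = M * t ^ (1 - ρ) := by
        rw [sub_eq_neg_add, Real.rpow_add_one ht0.ne']; ring
  · exact (Real.continuousAt_rpow_const x (-ρ) (Or.inl hx0.ne')).continuousWithinAt.mul (hG x hx)

/-- Pseudo-Grönwall lemma, part (a). -/
theorem pseudo_gronwall_a
    (ρ : ℝ) (hρ0 : 0 < ρ) (hρ1 : ρ < 1)
    (g ψ : ℝ → ℝ)
    (hg_cont : ContinuousOn g (Ici 0)) (hψ_cont : ContinuousOn ψ (Ici 0))
    (hg_nonneg : ∀ t ∈ Ici (0:ℝ), 0 ≤ g t) (hψ_nonneg : ∀ t ∈ Ici (0:ℝ), 0 ≤ ψ t)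
    (hineq : ∀ t > 0, g t ≤ ρ / t * (∫ s in (0:ℝ)..t, g s) + ψ t) :
    ∀ t > 0, g t ≤ ρ * t ^ (ρ - 1) * (∫ s in Ioc (0:ℝ) t, s ^ (-ρ) * ψ s) + ψ t := by
  intro t ht
  have hφ : IntegrableOn (fun s : ℝ => s ^ (-ρ) * ψ s) (Icc 0 t) := by
    rw [← intervalIntegrable_iff_integrableOn_Icc_of_le ht.le]
    refine (intervalIntegral.intervalIntegrable_rpow' (by linarith)).mul_continuousOn ?_
    rw [uIcc_of_le ht.le]
    exact hψ_cont.mono Icc_subset_Ici_self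
  have hderiv : ∀ x ∈ Ioo 0 t, HasDerivWithinAt
      (fun t => t ^ (-ρ) * ∫ s in (0:ℝ)..t, g s)
      (-ρ * x ^ (-ρ - 1) * (∫ s in (0:ℝ)..x, g s) + x ^ (-ρ) * g x) (Ioi x) x := by
    intro x hx
    have hG : HasDerivAt (fun t => ∫ s in (0:ℝ)..t, g s) (g x) x := by
      refine intervalIntegral.integral_hasDerivAt_right ?_ ?_
        (hg_cont.continuousAt (Ici_mem_nhds hx.1))
      · refine ContinuousOn.intervalIntegrable ?_
        rw [uIcc_of_le hx.1.le]
        exact hg_cont.mono Icc_subset_Ici_self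
      · exact (hg_cont.mono Ioi_subset_Ici_self).stronglyMeasurableAtFilter isOpen_Ioi x hx.1
    exact ((Real.hasDerivAt_rpow_const (Or.inl hx.1.ne')).mul hG).hasDerivWithinAt
  have key := intervalIntegral.sub_le_integral_of_hasDeriv_right_of_le ht.le
    (continuousOn_rpow_neg_mul_integral hρ1 ht.le (hg_cont.mono Icc_subset_Ici_self))
    hderiv hφ (by
      intro x hx
      have hpos : 0 < x ^ (-ρ) := Real.rpow_pos_of_pos hx.1 _
      have h := mul_le_mul_of_nonneg_left (hineq x hx.1) hpos.le
      rw [Real.rpow_sub_one hx.1.ne']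
      calc _ = x ^ (-ρ) * g x - x ^ (-ρ) * (ρ / x * ∫ s in (0:ℝ)..x, g s) := by ring
        _ ≤ _ := by linarith)
  rw [intervalIntegral.integral_same, mul_zero, sub_zero,
    intervalIntegral.integral_of_le (f := fun s => s ^ (-ρ) * ψ s) ht.le] at key
  calc g t ≤ ρ / t * (∫ s in (0:ℝ)..t, g s) + ψ t := hineq t ht
    _ = ρ * t ^ (ρ - 1) * (t ^ (-ρ) * ∫ s in (0:ℝ)..t, g s) + ψ t := by
      have h : t ^ (ρ - 1) * t ^ (-ρ) = t⁻¹ := by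
        rw [← Real.rpow_add ht, ← Real.rpow_neg_one]; ring_nf
      rw [div_eq_mul_inv, ← h]; ring
    _ ≤ _ := by gcongr
end

section
/- Let ρ ∈ (0,1) and let g, ψ : [0,∞) → [0,∞) be continuous functions such that g(t) ≤ (ρ/t)·∫₀ᵗ g(s) ds + ψ(t) for every t > 0. If moreover ψ is nondecreasing, then g(t) ≤ ψ(t)/(1−ρ) for every t > 0. -/
open MeasureTheory Set

/-- Pseudo-Grönwall lemma, part (a), monotone case. -/
theorem pseudo_gronwall_a_monotone
    (ρ : ℝ) (hρ0 : 0 < ρ) (hρ1 : ρ < 1)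
    (g ψ : ℝ → ℝ)
    (hg_cont : ContinuousOn g (Ici 0)) (hψ_cont : ContinuousOn ψ (Ici 0))
    (hg_nonneg : ∀ t ∈ Ici (0:ℝ), 0 ≤ g t) (hψ_nonneg : ∀ t ∈ Ici (0:ℝ), 0 ≤ ψ t)
    (hineq : ∀ t > 0, g t ≤ ρ / t * (∫ s in (0:ℝ)..t, g s) + ψ t)
    (hψ_mono : MonotoneOn ψ (Ici 0)) :
    ∀ t > 0, g t ≤ ψ t / (1 - ρ) := by
  intro T hT
  obtain ⟨c, hc, hmax⟩ := isCompact_Icc.exists_isMaxOn (nonempty_Icc.2 hT.le)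
    (hg_cont.mono (Icc_subset_Ici_self : Icc (0 : ℝ) T ⊆ Ici 0))
  have hIoc : ∀ t ∈ Ioc 0 T, g t ≤ ρ * g c + ψ T := by
    intro t ht
    have hint : ∫ s in (0 : ℝ)..t, g s ≤ g c * t := by
      have h := intervalIntegral.integral_mono_on (μ := volume) (g := fun _ => g c) ht.1.le
        ((hg_cont.mono Icc_subset_Ici_self).intervalIntegrable_of_Icc ht.1.le)
        intervalIntegrable_const
        (fun s hs => hmax ⟨hs.1, hs.2.trans ht.2⟩)
      simpa [mul_comm] using h
    calc g t ≤ ρ / t * (∫ s in (0 : ℝ)..t, g s) + ψ t := hineq t ht.1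
      _ ≤ ρ / t * (g c * t) + ψ T :=
        add_le_add (mul_le_mul_of_nonneg_left hint (div_pos hρ0 ht.1).le)
          (hψ_mono ht.1.le hT.le ht.2)
      _ = ρ * g c + ψ T := by
        have := ht.1.ne'
        field_simp
  have hclosure : closure (Ioc 0 T) = Icc 0 T := closure_Ioc hT.ne
  have hc_le : g c ≤ ρ * g c + ψ T :=
    le_on_closure hIoc (hclosure ▸ hg_cont.mono Icc_subset_Ici_self) continuousOn_const
      (hclosure ▸ hc)
  have hTc : g T ≤ g c := hmax (right_mem_Icc.2 hT.le)
  rw [le_div_iff₀ (sub_pos.2 hρ1)]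
  nlinarith
end

section
/- Let ρ ∈ (0,1), let f : [0,∞) → [0,∞) be continuous, define ψ(t) := (1/t)·∫₀ᵗ f(u) du for t > 0 and ψ(0) := f(0), and let g : [0,∞) → [0,∞) be continuous with g(t) ≤ (ρ/t)·∫₀ᵗ g(s) ds + ψ(t) for every t > 0. Then for every t > 0 one has g(t) ≤ t^{ρ−1}·∫₀ᵗ s^{−ρ} f(s) ds. -/
open MeasureTheory Set

/-- The fundamental theorem of calculus for an integrand continuous only on the open half-line. -/
lemma hasDerivAt_integral_of_continuousOn_Ioi {h : ℝ → ℝ} {t : ℝ} (ht : 0 < t)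
    (hint : IntervalIntegrable h volume 0 t) (hc : ContinuousOn h (Ioi 0)) :
    HasDerivAt (fun x => ∫ s in (0:ℝ)..x, h s) (h t) t :=
  intervalIntegral.integral_hasDerivAt_right hint
    (hc.stronglyMeasurableAtFilter isOpen_Ioi t ht)
    (hc.continuousAt (Ioi_mem_nhds ht))

/-- Pseudo-Grönwall lemma, part (b): the case `ψ(t) = (1/t) ∫₀ᵗ f`. -/
theorem pseudo_gronwall_b
    (ρ : ℝ) (hρ0 : 0 < ρ) (hρ1 : ρ < 1)
    (f g : ℝ → ℝ)
    (hf_cont : ContinuousOn f (Ici 0)) (hf_nonneg : ∀ t ∈ Ici (0:ℝ), 0 ≤ f t)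
    (hg_cont : ContinuousOn g (Ici 0)) (hg_nonneg : ∀ t ∈ Ici (0:ℝ), 0 ≤ g t)
    (ψ : ℝ → ℝ) (hψ0 : ψ 0 = f 0)
    (hψ : ∀ t > 0, ψ t = 1 / t * ∫ u in (0:ℝ)..t, f u)
    (hineq : ∀ t > 0, g t ≤ ρ / t * (∫ s in (0:ℝ)..t, g s) + ψ t) :
    ∀ t > 0, g t ≤ t ^ (ρ - 1) * ∫ s in Ioc (0:ℝ) t, s ^ (-ρ) * f s := by
  intro t ht
  have hsub : ∀ x : ℝ, 0 < x → uIcc 0 x ⊆ Ici 0 := fun x hx => by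
    rw [uIcc_of_le hx.le]; exact Icc_subset_Ici_self
  have hfi : ∀ x : ℝ, 0 < x → IntervalIntegrable f volume 0 x := fun x hx =>
    (hf_cont.mono (hsub x hx)).intervalIntegrable
  have hgi : ∀ x : ℝ, 0 < x → IntervalIntegrable g volume 0 x := fun x hx =>
    (hg_cont.mono (hsub x hx)).intervalIntegrable
  have hwi : ∀ x : ℝ, 0 < x → IntervalIntegrable (fun s => s ^ (-ρ) * f s) volume 0 x :=
    fun x hx => (intervalIntegral.intervalIntegrable_rpow' (by linarith)).mul_continuousOn
      (hf_cont.mono (hsub x hx))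
  have hwc : ContinuousOn (fun s : ℝ => s ^ (-ρ) * f s) (Ioi 0) :=
    (continuousOn_id.rpow_const fun x hx => Or.inl (ne_of_gt hx)).mul
      (hf_cont.mono Ioi_subset_Ici_self)
  set P : ℝ → ℝ := fun x => ρ * (∫ s in (0:ℝ)..x, g s) + ∫ s in (0:ℝ)..x, f s with hP
  set H : ℝ → ℝ := fun x => ∫ s in (0:ℝ)..x, s ^ (-ρ) * f s with hH
  have hgP : ∀ x : ℝ, 0 < x → g x ≤ P x / x := fun x hx => by
    refine (hineq x hx).trans_eq ?_
    rw [hψ x hx, hP]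
    field_simp
  have hderiv : ∀ x : ℝ, 0 < x → HasDerivAt (fun x => x ^ (-ρ) * P x - H x)
      (ρ * x ^ (-ρ) * (g x - P x / x)) x := fun x hx => by
    have hG := hasDerivAt_integral_of_continuousOn_Ioi hx (hgi x hx)
      (hg_cont.mono Ioi_subset_Ici_self)
    have hF := hasDerivAt_integral_of_continuousOn_Ioi hx (hfi x hx)
      (hf_cont.mono Ioi_subset_Ici_self)
    have hW := hasDerivAt_integral_of_continuousOn_Ioi hx (hwi x hx) hwc
    have hpow := Real.hasDerivAt_rpow_const (x := x) (p := -ρ) (Or.inl hx.ne')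
    refine ((hpow.mul ((hG.const_mul ρ).add hF)).sub hW).congr_deriv ?_
    rw [Real.rpow_sub_one hx.ne']
    simp only [hP, Pi.add_apply]
    field_simp
    ring
  have hanti : AntitoneOn (fun x => x ^ (-ρ) * P x - H x) (Ioi 0) := by
    refine antitoneOn_of_deriv_nonpos (convex_Ioi 0)
      (fun x hx => (hderiv x hx).continuousAt.continuousWithinAt) ?_ ?_
    · rw [interior_Ioi]
      exact fun x hx => (hderiv x hx).differentiableAt.differentiableWithinAt
    · rw [interior_Ioi]
      intro x hx
      rw [(hderiv x hx).deriv]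
      exact mul_nonpos_of_nonneg_of_nonpos
        (mul_nonneg hρ0.le (Real.rpow_nonneg (le_of_lt hx) _)) (sub_nonpos.2 (hgP x hx))
  obtain ⟨A, hA⟩ := isCompact_Icc.exists_bound_of_continuousOn
    (hg_cont.mono (Icc_subset_Ici_self : Icc 0 t ⊆ Ici 0))
  obtain ⟨B, hB⟩ := isCompact_Icc.exists_bound_of_continuousOn
    (hf_cont.mono (Icc_subset_Ici_self : Icc 0 t ⊆ Ici 0))
  have hbound : ∀ (h : ℝ → ℝ) (C : ℝ), (∀ x ∈ Icc 0 t, ‖h x‖ ≤ C) → ∀ x ∈ Ioc 0 t,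
      ∫ s in (0:ℝ)..x, h s ≤ C * x := fun h C hC x hx => by
    have := intervalIntegral.norm_integral_le_of_norm_le_const (a := 0) (b := x) (f := h) (C := C)
      fun s hs => by
        rw [uIoc_of_le hx.1.le] at hs
        exact hC s ⟨hs.1.le, hs.2.trans hx.2⟩
    rw [sub_zero, abs_of_pos hx.1] at this
    exact (Real.le_norm_self _).trans this
  have hsmall : ∀ x ∈ Ioc 0 t, t ^ (-ρ) * P t - H t ≤ (ρ * A + B) * x ^ (1 - ρ) := fun x hx => by
    refine (hanti hx.1 ht hx.2).trans ?_
    have hH0 : 0 ≤ H x := intervalIntegral.integral_nonneg hx.1.le fun s hs =>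
      mul_nonneg (Real.rpow_nonneg hs.1 _) (hf_nonneg s hs.1)
    have hPx : P x ≤ (ρ * A + B) * x := by
      have h1 := mul_le_mul_of_nonneg_left (hbound g A hA x hx) hρ0.le
      have h2 := hbound f B hB x hx
      simp only [hP]
      linarith
    have hpow : x ^ (1 - ρ) = x ^ (-ρ) * x := by
      rw [← Real.rpow_add_one hx.1.ne']; ring_nf
    have := mul_le_mul_of_nonneg_left hPx (Real.rpow_nonneg hx.1.le (-ρ))
    rw [hpow]
    simp only
    linarith
  have hlim : Filter.Tendsto (fun x : ℝ => (ρ * A + B) * x ^ (1 - ρ)) (nhdsWithin 0 (Ioi 0))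
      (nhds 0) := by
    have h := ((Real.continuousAt_rpow_const 0 (1 - ρ) (Or.inr (by linarith))).const_mul
      (ρ * A + B)).tendsto
    rw [Real.zero_rpow (by linarith), mul_zero] at h
    exact h.mono_left nhdsWithin_le_nhds
  have hle : t ^ (-ρ) * P t - H t ≤ 0 :=
    ge_of_tendsto hlim (Filter.mem_of_superset (Ioc_mem_nhdsGT ht) hsmall)
  rw [← intervalIntegral.integral_of_le ht.le]
  calc g t ≤ P t / t := hgP t ht
    _ = t ^ (ρ - 1) * (t ^ (-ρ) * P t) := by
      rw [← mul_assoc, ← Real.rpow_add ht, show ρ - 1 + -ρ = -1 by ring, Real.rpow_neg_one]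
      ring
    _ ≤ t ^ (ρ - 1) * H t :=
      mul_le_mul_of_nonneg_left (by linarith) (Real.rpow_nonneg ht.le _)
end

section
/- Let ρ ∈ (0,1) and let g, ψ : [0,∞) → [0,∞) be continuous functions such that g(t) ≤ (ρ/t)·∫₀ᵗ g(s) ds + ψ(t) for every t > 0. If ψ(t) → 0 as t → ∞, then g(t) → 0 as t → ∞. -/
open MeasureTheory Set Filter

/-- The primitive of a function continuous on `[0, ∞)` is differentiable at every positive point. -/
lemma hasDerivAt_integral_of_continuousOn_Ici {g : ℝ → ℝ} (hg : ContinuousOn g (Ici 0))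
    {t : ℝ} (ht : 0 < t) : HasDerivAt (fun u => ∫ s in (0 : ℝ)..u, g s) (g t) t := by
  refine intervalIntegral.integral_hasDerivAt_right ?_ ?_ (hg.continuousAt (Ici_mem_nhds ht))
  · refine (hg.mono fun x hx => ?_).intervalIntegrable
    rw [uIcc_of_le ht.le] at hx
    exact hx.1
  · exact (hg.mono Ioi_subset_Ici_self).stronglyMeasurableAtFilter isOpen_Ioi t ht

/-- If `A' ≤ ρ A / t + ε` on `[T, ∞)`, then `t ^ (-ρ) A(t) - ε t ^ (1 - ρ) / (1 - ρ)` is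
nonincreasing there. -/
lemma antitoneOn_of_deriv_le_div_add {ρ ε T : ℝ} (hρ : ρ < 1) (hT : 0 < T) {A g : ℝ → ℝ}
    (hA : ∀ t, T ≤ t → HasDerivAt A (g t) t) (hg : ∀ t, T ≤ t → g t ≤ ρ / t * A t + ε) :
    AntitoneOn (fun t => A t * t ^ (-ρ) - ε / (1 - ρ) * t ^ (1 - ρ)) (Ici T) := by
  have hd : ∀ t, T ≤ t → HasDerivAt (fun t => A t * t ^ (-ρ) - ε / (1 - ρ) * t ^ (1 - ρ))
      (t ^ (-ρ) * (g t - (ρ / t * A t + ε))) t := by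
    intro t ht
    have ht0 : 0 < t := hT.trans_le ht
    have h := ((hA t ht).mul (Real.hasDerivAt_rpow_const (p := -ρ) (Or.inl ht0.ne'))).sub
      ((Real.hasDerivAt_rpow_const (p := 1 - ρ) (Or.inl ht0.ne')).const_mul (ε / (1 - ρ)))
    refine h.congr_deriv ?_
    have h1 : (1 : ℝ) - ρ ≠ 0 := by linarith
    rw [Real.rpow_sub_one ht0.ne', show 1 - ρ - 1 = -ρ by ring]
    field_simp
    ring
  refine antitoneOn_of_deriv_nonpos (convex_Ici T)
    (fun t ht => (hd t ht).continuousAt.continuousWithinAt)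
    (fun t ht => (hd t (interior_subset ht)).differentiableAt.differentiableWithinAt) ?_
  intro t ht
  have ht : T ≤ t := interior_subset ht
  rw [(hd t ht).deriv]
  exact mul_nonpos_of_nonneg_of_nonpos (Real.rpow_nonneg (hT.le.trans ht) _)
    (by linarith [hg t ht])

/-- Pseudo-Grönwall lemma, part (c). -/
theorem pseudo_gronwall_c
    (ρ : ℝ) (hρ0 : 0 < ρ) (hρ1 : ρ < 1)
    (g ψ : ℝ → ℝ)
    (hg_cont : ContinuousOn g (Ici 0)) (hψ_cont : ContinuousOn ψ (Ici 0))
    (hg_nonneg : ∀ t ∈ Ici (0:ℝ), 0 ≤ g t) (hψ_nonneg : ∀ t ∈ Ici (0:ℝ), 0 ≤ ψ t)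
    (hineq : ∀ t > 0, g t ≤ ρ / t * (∫ s in (0:ℝ)..t, g s) + ψ t)
    (hψ_lim : Tendsto ψ atTop (nhds 0)) :
    Tendsto g atTop (nhds 0) := by
  set A : ℝ → ℝ := fun t => ∫ s in (0:ℝ)..t, g s with hAdef
  have hA0 : ∀ t, 0 ≤ t → 0 ≤ A t := fun t ht =>
    intervalIntegral.integral_nonneg ht fun s hs => hg_nonneg s hs.1
  have hmean : Tendsto (fun t => A t / t) atTop (nhds 0) := by
    rw [tendsto_order]
    refine ⟨fun a ha => ?_, fun δ hδ => ?_⟩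
    · filter_upwards [eventually_ge_atTop 0] with t ht
      exact ha.trans_le (div_nonneg (hA0 t ht) ht)
    have h1ρ : 0 < 1 - ρ := by linarith
    set ε := δ / 2 * (1 - ρ) with hε
    have hεpos : 0 < ε := by positivity
    obtain ⟨T, hT⟩ := eventually_atTop.1
      ((hψ_lim.eventually (ge_mem_nhds hεpos)).and (eventually_gt_atTop 0))
    have hanti := antitoneOn_of_deriv_le_div_add (ε := ε) hρ1 (hT T le_rfl).2
      (fun t ht => hasDerivAt_integral_of_continuousOn_Ici hg_cont (hT t ht).2)
      (fun t ht => (hineq t (hT t ht).2).trans (by gcongr; exact (hT t ht).1))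
    set C := A T * T ^ (-ρ) - ε / (1 - ρ) * T ^ (1 - ρ) with hC
    have hlim : Tendsto (fun t : ℝ => C * t ^ (-(1 - ρ))) atTop (nhds 0) := by
      simpa using (tendsto_rpow_neg_atTop h1ρ).const_mul C
    filter_upwards [hlim.eventually (gt_mem_nhds (half_pos hδ)), eventually_ge_atTop T]
      with t hCt ht
    have ht0 := (hT t ht).2
    have hle : A t * t ^ (-ρ) - ε / (1 - ρ) * t ^ (1 - ρ) ≤ C :=
      hanti self_mem_Ici ht ht
    have hεδ : ε / (1 - ρ) = δ / 2 := by rw [hε]; field_simp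
    rw [hεδ] at hle
    have hmul := mul_le_mul_of_nonneg_right hle (Real.rpow_nonneg ht0.le (-(1 - ρ)))
    have e1 : t ^ (-ρ) * t ^ (-(1 - ρ)) = t⁻¹ := by
      rw [← Real.rpow_add ht0, ← Real.rpow_neg_one]; ring_nf
    have e2 : t ^ (1 - ρ) * t ^ (-(1 - ρ)) = 1 := by
      rw [← Real.rpow_add ht0, add_neg_cancel, Real.rpow_zero]
    rw [sub_mul, mul_assoc, mul_assoc, e1, e2, ← div_eq_mul_inv] at hmul
    linarith
  have hbound : Tendsto (fun t => ρ * (A t / t) + ψ t) atTop (nhds 0) := by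
    simpa using (hmean.const_mul ρ).add hψ_lim
  refine squeeze_zero' ?_ ?_ hbound
  · filter_upwards [eventually_ge_atTop 0] with t ht using hg_nonneg t ht
  · filter_upwards [eventually_gt_atTop 0] with t ht
    exact (hineq t ht).trans_eq (by rw [hAdef]; ring)
end

section
/- Let 𝔡 > 0 and 𝔟 ∈ ℝ, and let S be the set of pairs (m, y) ∈ ℝ × [0,∞) satisfying m = 𝔟·(√y − 𝔡) and y = m² + 𝔡². If |𝔟| ≤ 1 then S = {(0, 𝔡²)}. If |𝔟| > 1 then S consists of exactly the two pairs (0, 𝔡²) and (2𝔟𝔡/(𝔟²−1), 𝔡²(1+𝔟²)²/(𝔟²−1)²). -/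
/-- A solution of the system either has mean zero or has `√y` determined by `b` and `d`. -/
lemma fixed_point_dichotomy {d b m y : ℝ} (hy : 0 ≤ y) (hm : m = b * (√y - d))
    (hym : y = m ^ 2 + d ^ 2) : √y = d ∨ √y * (b ^ 2 - 1) = d * (1 + b ^ 2) := by
  have hs : √y ^ 2 = m ^ 2 + d ^ 2 := (Real.sq_sqrt hy).trans hym
  rw [hm] at hs
  have h : (√y - d) * (√y * (b ^ 2 - 1) - d * (1 + b ^ 2)) = 0 := by linear_combination -hs
  exact (mul_eq_zero.mp h).imp sub_eq_zero.mp sub_eq_zero.mp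

/-- The pair `(0, d²)` always solves the system. -/
lemma trivial_fixed_point {d : ℝ} (b : ℝ) (hd : 0 ≤ d) :
    0 ≤ d ^ 2 ∧ 0 = b * (√(d ^ 2) - d) ∧ d ^ 2 = 0 ^ 2 + d ^ 2 := by
  refine ⟨sq_nonneg d, ?_, by ring⟩
  rw [Real.sqrt_sq hd, sub_self, mul_zero]

/-- A solution with `√y = d` is the trivial one. -/
lemma eq_trivial_fixed_point {d b m y : ℝ} (hm : m = b * (√y - d))
    (hym : y = m ^ 2 + d ^ 2) (h : √y = d) : (m, y) = (0, d ^ 2) := by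
  have hm0 : m = 0 := by rw [hm, h, sub_self, mul_zero]
  rw [hym, hm0]
  simp

/-- Fixed-point system for the Gaussian stationary measures of the nonlinear mean-field
Ornstein–Uhlenbeck model: characterization of the pairs `(m, y)` with
`m = 𝔟(√y - 𝔡)` and `y = m² + 𝔡²`. -/
theorem nonlinear_OU_stationary_fixed_points (d b : ℝ) (hd : 0 < d) :
    (|b| ≤ 1 →
      {p : ℝ × ℝ | 0 ≤ p.2 ∧ p.1 = b * (Real.sqrt p.2 - d) ∧ p.2 = p.1 ^ 2 + d ^ 2}
        = {((0 : ℝ), d ^ 2)}) ∧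
    (1 < |b| →
      {p : ℝ × ℝ | 0 ≤ p.2 ∧ p.1 = b * (Real.sqrt p.2 - d) ∧ p.2 = p.1 ^ 2 + d ^ 2}
        = {((0 : ℝ), d ^ 2),
            (2 * b * d / (b ^ 2 - 1), d ^ 2 * (1 + b ^ 2) ^ 2 / (b ^ 2 - 1) ^ 2)}) := by
  refine ⟨fun hb => ?_, fun hb => ?_⟩
  · ext ⟨m, y⟩
    simp only [Set.mem_ofPred_eq, Set.mem_singleton_iff]
    constructor
    · rintro ⟨hy, hm, hym⟩
      rcases fixed_point_dichotomy hy hm hym with h | h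
      · exact eq_trivial_fixed_point hm hym h
      · have hb2 : b ^ 2 ≤ 1 := (sq_le_one_iff_abs_le_one b).mpr hb
        have hle : √y * (b ^ 2 - 1) ≤ 0 :=
          mul_nonpos_of_nonneg_of_nonpos (Real.sqrt_nonneg y) (by linarith)
        have hpos : 0 < d * (1 + b ^ 2) := by positivity
        linarith
    · rintro ⟨⟩
      exact trivial_fixed_point b hd.le
  · have hb2 : 0 < b ^ 2 - 1 := sub_pos.mpr ((one_lt_sq_iff_one_lt_abs b).mpr hb)
    ext ⟨m, y⟩
    simp only [Set.mem_ofPred_eq, Set.mem_insert_iff, Set.mem_singleton_iff]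
    constructor
    · rintro ⟨hy, hm, hym⟩
      refine (fixed_point_dichotomy hy hm hym).imp (eq_trivial_fixed_point hm hym) fun h => ?_
      have hs : √y = d * (1 + b ^ 2) / (b ^ 2 - 1) := (eq_div_iff hb2.ne').mpr h
      refine Prod.ext ?_ ?_
      · change m = _
        rw [hm, hs]
        field_simp
        ring
      · change y = _
        rw [← Real.sq_sqrt hy, hs, div_pow, mul_pow]
    · rintro (⟨⟨⟩⟩ | ⟨⟨⟩⟩)
      · exact trivial_fixed_point b hd.le
      · have hs : √(d ^ 2 * (1 + b ^ 2) ^ 2 / (b ^ 2 - 1) ^ 2)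
            = d * (1 + b ^ 2) / (b ^ 2 - 1) := by
          rw [← mul_pow, ← div_pow]
          exact Real.sqrt_sq (by positivity)
        refine ⟨by positivity, ?_, ?_⟩
        · rw [hs]
          field_simp
          ring
        · field_simp
          ring
end

section
/- Let (γ_n)_{n≥1} be positive real numbers, let a > b ≥ 0, K ≥ 0, θ ∈ [0,1), and let n₀ ≥ 0 be such that a·γ_{n+1} ≤ 1 for every n ≥ n₀. Let (x_n)_{n≥0} be nonnegative real numbers satisfying, for every n ≥ n₀, x_{n+1} ≤ (1 − a·γ_{n+1})·x_n + b·γ_{n+1}·max_{0≤ℓ≤n} x_ℓ + K·γ_{n+1}·x_n^{θ}. Then sup_{n≥0} x_n ≤ max( max_{0≤ℓ≤n₀} x_ℓ , (K/(a−b))^{1/(1−θ)} ). -/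
/-- The maximum `max_{0 ≤ ℓ ≤ n} x ℓ` of the first `n+1` terms of a real sequence. -/
noncomputable def maxUpTo (x : ℕ → ℝ) (n : ℕ) : ℝ :=
  (Finset.range (n + 1)).sup' (Finset.nonempty_range_iff.mpr (Nat.succ_ne_zero n)) x

theorem le_maxUpTo (x : ℕ → ℝ) {k n : ℕ} (h : k ≤ n) : x k ≤ maxUpTo x n :=
  Finset.le_sup' x (Finset.mem_range.mpr (Nat.lt_succ_of_le h))

theorem maxUpTo_le {x : ℕ → ℝ} {n : ℕ} {M : ℝ} (h : ∀ k ≤ n, x k ≤ M) : maxUpTo x n ≤ M :=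
  Finset.sup'_le _ _ fun k hk => h k (Nat.le_of_lt_succ (Finset.mem_range.mp hk))

/-- Above the fixed point `(K / c) ^ (1 / (1 - θ))`, the sublinear term `K * M ^ θ` is dominated
by the linear term `c * M`. -/
theorem mul_rpow_le_mul_of_rpow_le {c K θ M : ℝ} (hc : 0 < c) (hK : 0 ≤ K) (hθ0 : 0 ≤ θ)
    (hθ1 : θ < 1) (hM : (K / c) ^ (1 / (1 - θ)) ≤ M) : K * M ^ θ ≤ c * M := by
  have hKc : 0 ≤ K / c := by positivity
  have hθ : 0 < 1 - θ := sub_pos.mpr hθ1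
  have hM0 : 0 ≤ M := (Real.rpow_nonneg hKc _).trans hM
  have hle : K / c ≤ M ^ (1 - θ) := by
    have h := Real.rpow_le_rpow (Real.rpow_nonneg hKc _) hM hθ.le
    rwa [← Real.rpow_mul hKc, one_div_mul_cancel hθ.ne', Real.rpow_one] at h
  have hsplit : M ^ (1 - θ) * M ^ θ = M := by
    rw [← Real.rpow_add_of_nonneg hM0 hθ.le hθ0, sub_add_cancel, Real.rpow_one]
  calc K * M ^ θ ≤ (M ^ (1 - θ) * c) * M ^ θ :=
        mul_le_mul_of_nonneg_right ((div_le_iff₀ hc).mp hle) (Real.rpow_nonneg hM0 _)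
    _ = c * (M ^ (1 - θ) * M ^ θ) := by ring
    _ = c * M := by rw [hsplit]

/-- Deterministic sequence lemma underlying the uniform boundedness of the moments of the
decreasing-step Euler scheme. -/
theorem discrete_recursive_bound
    (γ : ℕ → ℝ) (a b K θ : ℝ) (n₀ : ℕ)
    (hγ : ∀ n ≥ 1, 0 < γ n)
    (hba : b < a) (hb : 0 ≤ b) (hK : 0 ≤ K) (hθ0 : 0 ≤ θ) (hθ1 : θ < 1)
    (hstep : ∀ n ≥ n₀, a * γ (n + 1) ≤ 1)
    (x : ℕ → ℝ) (hx : ∀ n, 0 ≤ x n)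
    (hrec : ∀ n ≥ n₀,
      x (n + 1) ≤ (1 - a * γ (n + 1)) * x n + b * γ (n + 1) * maxUpTo x n
        + K * γ (n + 1) * x n ^ θ) :
    ∀ n, x n ≤ max (maxUpTo x n₀) ((K / (a - b)) ^ (1 / (1 - θ))) := by
  intro n
  set M := max (maxUpTo x n₀) ((K / (a - b)) ^ (1 / (1 - θ)))
  have hfix : K * M ^ θ ≤ (a - b) * M :=
    mul_rpow_le_mul_of_rpow_le (sub_pos.mpr hba) hK hθ0 hθ1 (le_max_right _ _)
  induction n using Nat.strong_induction_on with
  | _ n ih =>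
    rcases le_or_gt n n₀ with hn | hn
    · exact (le_maxUpTo x hn).trans (le_max_left _ _)
    · obtain ⟨m, rfl⟩ := Nat.exists_eq_succ_of_ne_zero (Nat.ne_zero_of_lt hn)
      have hm : n₀ ≤ m := Nat.le_of_lt_succ hn
      have hg : 0 < γ (m + 1) := hγ _ (Nat.le_add_left 1 m)
      have hxm : x m ≤ M := ih m (Nat.lt_succ_self m)
      have hmax : maxUpTo x m ≤ M := maxUpTo_le fun k hk => ih k (Nat.lt_succ_of_le hk)
      have hcoef : 0 ≤ 1 - a * γ (m + 1) := sub_nonneg.mpr (hstep m hm)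
      have hpow : x m ^ θ ≤ M ^ θ := Real.rpow_le_rpow (hx m) hxm hθ0
      calc x (m + 1) ≤ (1 - a * γ (m + 1)) * x m + b * γ (m + 1) * maxUpTo x m
            + K * γ (m + 1) * x m ^ θ := hrec m hm
        _ ≤ (1 - a * γ (m + 1)) * M + b * γ (m + 1) * M + K * γ (m + 1) * M ^ θ := by gcongr
        _ = M + γ (m + 1) * (K * M ^ θ - (a - b) * M) := by ring
        _ ≤ M := by
          linarith [mul_nonpos_of_nonneg_of_nonpos hg.le (sub_nonpos.mpr hfix)]
end

section
/- Let λ > 0, ρ ∈ (0,1) and η > 0. Define f(s) := ∫_s^∞ u^{−ρ}·e^{−λu} du and h(s) := s^{max(1/2−ρ, 0)}·(log s)^{1/2+η} for s ≥ 2. Then ∫₂^∞ ( e^{λs}·f(s)/h(s) )² ds < ∞. -/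
open MeasureTheory Set Real

/-- For `p > 1`, the function `t⁻¹ (log t)^{-p}` is integrable at infinity. -/
theorem integrableOn_inv_mul_log_rpow_neg_Ioi {p c : ℝ} (hp : 1 < p) (hc : 1 < c) :
    IntegrableOn (fun t : ℝ => t⁻¹ * Real.log t ^ (-p)) (Ioi c) := by
  have hlim : Filter.Tendsto (fun t : ℝ => -(Real.log t ^ (-(p - 1)) / (p - 1)))
      Filter.atTop (nhds (-(0 / (p - 1)))) :=
    (((tendsto_rpow_neg_atTop (by linarith : 0 < p - 1)).comp
      tendsto_log_atTop).div_const _).neg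
  refine integrableOn_Ioi_deriv_of_nonneg' (fun t ht => ?_) (fun t ht => ?_) hlim
  · have ht1 : 1 < t := hc.trans_le ht
    have hlog : 0 < Real.log t := Real.log_pos ht1
    have hd := (((Real.hasDerivAt_log (by linarith : t ≠ 0)).rpow_const
      (p := -(p - 1)) (Or.inl hlog.ne')).div_const (p - 1)).neg
    refine hd.congr_deriv ?_
    have : p - 1 ≠ 0 := by linarith
    rw [show -(p - 1) - 1 = -p by ring]
    field_simp
  · have ht1 : 1 < t := hc.trans ht
    have := Real.log_pos ht1
    positivity

/-- The integrand `u^{-ρ} e^{-λu}` is integrable on `(s,∞)` for `s > 0`. -/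
theorem integrableOn_rpow_neg_mul_exp_Ioi {lam ρ s : ℝ} (hlam : 0 < lam) (hρ : 0 ≤ ρ)
    (hs : 0 < s) :
    IntegrableOn (fun u : ℝ => u ^ (-ρ) * Real.exp (-lam * u)) (Ioi s) := by
  refine Integrable.mono' ((integrableOn_exp_mul_Ioi (neg_lt_zero.2 hlam) s).const_mul (s ^ (-ρ)))
    (by fun_prop) ?_
  filter_upwards [ae_restrict_mem measurableSet_Ioi] with u hu
  have hu0 : 0 < u := hs.trans hu
  rw [Real.norm_of_nonneg (by positivity)]
  gcongr ?_ * _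
  exact Real.rpow_le_rpow_of_nonpos hs (le_of_lt hu) (by linarith)

/-- The tail integral of `u^{-ρ} e^{-λu}` over `(s,∞)` is at most `s^{-ρ} e^{-λs} / λ`. -/
theorem integral_rpow_neg_mul_exp_Ioi_le {lam ρ s : ℝ} (hlam : 0 < lam) (hρ : 0 ≤ ρ)
    (hs : 0 < s) :
    ∫ u in Ioi s, u ^ (-ρ) * Real.exp (-lam * u) ≤ s ^ (-ρ) * (Real.exp (-lam * s) / lam) := by
  have hexp : ∫ u in Ioi s, Real.exp (-lam * u) = Real.exp (-lam * s) / lam := by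
    rw [integral_exp_mul_Ioi (neg_lt_zero.2 hlam) s, neg_div_neg_eq]
  rw [← hexp, ← integral_const_mul]
  refine setIntegral_mono_on (integrableOn_rpow_neg_mul_exp_Ioi hlam hρ hs)
    ((integrableOn_exp_mul_Ioi (neg_lt_zero.2 hlam) s).const_mul _) measurableSet_Ioi ?_
  intro u hu
  gcongr ?_ * _
  exact Real.rpow_le_rpow_of_nonpos hs (le_of_lt hu) (by linarith)

/-- The tail integral of `u^{-ρ} e^{-λu}` is antitone in its lower limit. -/
theorem antitoneOn_integral_rpow_neg_mul_exp_Ioi {lam ρ : ℝ} (hlam : 0 < lam) (hρ : 0 ≤ ρ) :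
    AntitoneOn (fun s : ℝ => ∫ u in Ioi s, u ^ (-ρ) * Real.exp (-lam * u)) (Ioi 0) := by
  intro a ha b _ hab
  refine setIntegral_mono_set (integrableOn_rpow_neg_mul_exp_Ioi hlam hρ ha) ?_
    (Ioi_subset_Ioi hab).eventuallyLE
  filter_upwards [ae_restrict_mem measurableSet_Ioi] with u hu
  have hu0 : 0 < u := lt_trans ha hu
  simp only [Pi.zero_apply]
  positivity

/-- Square-integrability of the weight `e^{λs} f(s)/h(s)` on `[2,∞)`, where
`f(s) = ∫ₛ^∞ u^{-ρ} e^{-λu} du` and `h(s) = s^{max(1/2-ρ,0)} (log s)^{1/2+η}`. -/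
theorem martingale_weight_square_integrable
    (lam ρ η : ℝ) (hlam : 0 < lam) (hρ0 : 0 < ρ) (hρ1 : ρ < 1) (hη : 0 < η) :
    IntegrableOn
      (fun s : ℝ =>
        (Real.exp (lam * s) * (∫ u in Ioi s, u ^ (-ρ) * Real.exp (-lam * u)) /
            (s ^ max (1 / 2 - ρ) 0 * Real.log s ^ (1 / 2 + η))) ^ 2)
      (Ici (2:ℝ)) := by
  rw [integrableOn_Ici_iff_integrableOn_Ioi]
  have hmeas : AEMeasurable (fun s : ℝ => ∫ u in Ioi s, u ^ (-ρ) * Real.exp (-lam * u))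
      (volume.restrict (Ioi 2)) :=
    aemeasurable_restrict_of_antitoneOn measurableSet_Ioi
      ((antitoneOn_integral_rpow_neg_mul_exp_Ioi hlam hρ0.le).mono (Ioi_subset_Ioi zero_le_two))
  refine Integrable.mono' ((integrableOn_inv_mul_log_rpow_neg_Ioi
    (by linarith : 1 < 1 + 2 * η) one_lt_two).const_mul ((lam⁻¹) ^ 2)) ?_ ?_
  · refine AEMeasurable.aestronglyMeasurable ?_
    have h1 : Measurable fun s : ℝ => Real.exp (lam * s) := by fun_prop
    have h2 : Measurable fun s : ℝ => s ^ max (1 / 2 - ρ) 0 * Real.log s ^ (1 / 2 + η) := by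
      fun_prop
    exact ((h1.aemeasurable.mul hmeas).div h2.aemeasurable).pow_const 2
  filter_upwards [ae_restrict_mem measurableSet_Ioi] with s hs
  have hs1 : 1 < s := one_lt_two.trans hs
  have hs0 : 0 < s := by linarith
  have hlog : 0 < Real.log s := Real.log_pos hs1
  have hint : 0 ≤ ∫ u in Ioi s, u ^ (-ρ) * Real.exp (-lam * u) :=
    setIntegral_nonneg measurableSet_Ioi fun u hu => by
      have hu0 : 0 < u := hs0.trans hu
      positivity
  have hnum : Real.exp (lam * s) * (∫ u in Ioi s, u ^ (-ρ) * Real.exp (-lam * u)) ≤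
      lam⁻¹ * s ^ (-ρ) := by
    refine (mul_le_mul_of_nonneg_left (integral_rpow_neg_mul_exp_Ioi_le hlam hρ0.le hs0)
      (Real.exp_pos _).le).trans_eq ?_
    rw [neg_mul, Real.exp_neg]
    field_simp
  have hpow : s ^ (-ρ) / s ^ max (1 / 2 - ρ) 0 ≤ s ^ (-(1 / 2) : ℝ) := by
    rw [← Real.rpow_sub hs0]
    exact Real.rpow_le_rpow_of_exponent_le hs1.le (by linarith [le_max_left (1 / 2 - ρ) 0])
  have hle : Real.exp (lam * s) * (∫ u in Ioi s, u ^ (-ρ) * Real.exp (-lam * u)) /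
      (s ^ max (1 / 2 - ρ) 0 * Real.log s ^ (1 / 2 + η)) ≤
      lam⁻¹ * (s ^ (-(1 / 2) : ℝ) * Real.log s ^ (-(1 / 2 + η))) := by
    calc _ ≤ lam⁻¹ * s ^ (-ρ) / (s ^ max (1 / 2 - ρ) 0 * Real.log s ^ (1 / 2 + η)) := by gcongr
      _ = lam⁻¹ * (s ^ (-ρ) / s ^ max (1 / 2 - ρ) 0 * Real.log s ^ (-(1 / 2 + η))) := by
        rw [Real.rpow_neg hlog.le]
        field_simp
      _ ≤ _ := by gcongr
  rw [Real.norm_of_nonneg (by positivity)]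
  refine (pow_le_pow_left₀ (by positivity) hle 2).trans_eq ?_
  rw [mul_pow, mul_pow, ← Real.rpow_mul_natCast hs0.le, ← Real.rpow_mul_natCast hlog.le,
    ← Real.rpow_neg_one s]
  push_cast
  ring_nf
end
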